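/- arXiv:1801.04893 — 3 statements merged into one kernel-verified Lean document; each statement's English description precedes it below -/
import Mathlib

section
/- Let k be a perfect field of characteristic p > 2, let R = k[x₀,…,x_n] be a polynomial ring, and let f ∈ R be nonzero. If the level of f is 1, then the principal ideal (f) has no F-jumping exponent in the open interval (0,1). If the level of f is strictly greater than 2, then (f) has an F-jumping exponent in the open interval (1 − 1/p, 1). -/
/-- The bracket power `J^{[q]}` of an ideal: the ideal generated by `q`-th powers
of elements of `J`. -/
noncomputable def bracketPow {R : Type*} [CommRing R] (J : Ideal R) (q : ℕ) : Ideal R :=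
  Ideal.span ((fun a => a ^ q) '' (J : Set R))

/-- The `p^e`-th root ideal `(g)^{[1/q]}`: the smallest ideal `J` with `g ∈ J^{[q]}`. -/
noncomputable def rootIdeal {R : Type*} [CommRing R] (g : R) (q : ℕ) : Ideal R :=
  sInf {J : Ideal R | g ∈ bracketPow J q}

/-- The descending chain of ideals `(f^{p^e-1})^{[1/p^e]}`. -/
noncomputable def levelChain {R : Type*} [CommRing R] (f : R) (p : ℕ) (e : ℕ) : Ideal R :=
  rootIdeal (f ^ (p ^ e - 1)) (p ^ e)

/-- The level of `f`: `e + 1` where `e` is the least index at which the chain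
`(f^{p^e-1})^{[1/p^e]}` becomes constant. -/
noncomputable def level {R : Type*} [CommRing R] (f : R) (p : ℕ) : ℕ :=
  sInf {e : ℕ | ∀ e', e ≤ e' → levelChain f p e' = levelChain f p e} + 1

/-- The generalised test ideal `τ(f^λ)`: the stable (= supremum) value of the
ascending chain `((f^{⌈λ p^e⌉}))^{[1/p^e]}`. -/
noncomputable def testIdeal {R : Type*} [CommRing R] (f : R) (p : ℕ) (lam : ℝ) : Ideal R :=
  ⨆ e : ℕ, rootIdeal (f ^ ⌈lam * (p : ℝ) ^ e⌉₊) (p ^ e)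

/-- `λ > 0` is an `F`-jumping exponent of `(f)` if `τ(f^λ') ≠ τ(f^λ)` for all
`0 < λ' < λ`. -/
def IsFJumpingExponent {R : Type*} [CommRing R] (f : R) (p : ℕ) (lam : ℝ) : Prop :=
  0 < lam ∧ ∀ lam' : ℝ, 0 < lam' → lam' < lam → testIdeal f p lam' ≠ testIdeal f p lam

section BracketPow

variable {R : Type*} [CommRing R]

theorem pow_mem_bracketPow {J : Ideal R} {a : R} (ha : a ∈ J) (q : ℕ) : a ^ q ∈ bracketPow J q :=
  Ideal.subset_span ⟨a, ha, rfl⟩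

theorem bracketPow_mul_le (J : Ideal R) (q r : ℕ) :
    bracketPow J (q * r) ≤ bracketPow (bracketPow J q) r := by
  refine Ideal.span_le.2 ?_
  rintro _ ⟨a, ha, rfl⟩
  simpa only [SetLike.mem_coe, pow_mul] using pow_mem_bracketPow (pow_mem_bracketPow ha q) r

theorem pow_mem_bracketPow_mul {p : ℕ} [Fact p.Prime] [CharP R p] {J : Ideal R} {g : R} {q : ℕ}
    (hg : g ∈ bracketPow J q) (m : ℕ) : g ^ p ^ m ∈ bracketPow J (q * p ^ m) := by
  have hle : bracketPow J q ≤ (bracketPow J (q * p ^ m)).comap (iterateFrobenius R p m) := by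
    refine Ideal.span_le.2 ?_
    rintro _ ⟨a, ha, rfl⟩
    simpa only [SetLike.mem_coe, Ideal.mem_comap, iterateFrobenius_def, ← pow_mul] using
      pow_mem_bracketPow ha (q * p ^ m)
  exact hle hg

theorem rootIdeal_le_rootIdeal {g h : R} {q r : ℕ}
    (H : ∀ J : Ideal R, h ∈ bracketPow J r → g ∈ bracketPow J q) :
    rootIdeal g q ≤ rootIdeal h r :=
  sInf_le_sInf H

theorem rootIdeal_pow_anti (f : R) (q : ℕ) {a b : ℕ} (hab : a ≤ b) :
    rootIdeal (f ^ b) q ≤ rootIdeal (f ^ a) q :=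
  rootIdeal_le_rootIdeal fun J h ↦ (bracketPow J q).mem_of_dvd (pow_dvd_pow f hab) h

theorem rootIdeal_pow_le {p : ℕ} [Fact p.Prime] [CharP R p] (g : R) (q m : ℕ) :
    rootIdeal (g ^ p ^ m) (q * p ^ m) ≤ rootIdeal g q :=
  rootIdeal_le_rootIdeal fun _ h ↦ pow_mem_bracketPow_mul h m

theorem levelChain_zero (f : R) (p : ℕ) : levelChain f p 0 = ⊤ := by
  refine top_le_iff.1 (le_sInf fun J hJ ↦ ?_)
  have hle : bracketPow J (p ^ 0) ≤ J := by
    refine Ideal.span_le.2 ?_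
    rintro _ ⟨a, ha, rfl⟩
    simpa using ha
  simpa [Ideal.eq_top_iff_one] using hle hJ

theorem levelChain_antitone {p : ℕ} [Fact p.Prime] [CharP R p] (f : R) :
    Antitone (levelChain f p) := by
  intro a b hab
  obtain ⟨m, rfl⟩ := Nat.exists_eq_add_of_le hab
  have hexp : (p ^ a - 1) * p ^ m ≤ p ^ (a + m) - 1 := by
    rw [Nat.sub_mul, ← pow_add, one_mul]
    exact Nat.sub_le_sub_left (Nat.one_le_pow _ _ (Fact.out : p.Prime).pos) _
  calc levelChain f p (a + m) ≤ rootIdeal (f ^ ((p ^ a - 1) * p ^ m)) (p ^ (a + m)) :=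
        rootIdeal_pow_anti f _ hexp
    _ ≤ levelChain f p a := by
        rw [pow_mul, pow_add]
        exact rootIdeal_pow_le _ _ _

theorem testIdeal_antitone (f : R) (p : ℕ) : Antitone (testIdeal f p) := fun _ _ h ↦
  iSup_mono fun _ ↦ rootIdeal_pow_anti f _ <| Nat.ceil_mono <|
    mul_le_mul_of_nonneg_right h (by positivity)

theorem rootIdeal_le_testIdeal {p : ℕ} (hp : 0 < p) (f : R) (r e : ℕ) :
    rootIdeal (f ^ r) (p ^ e) ≤ testIdeal f p (r / (p : ℝ) ^ e) := by
  refine le_trans (le_of_eq ?_) (le_iSup _ e)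
  rw [div_mul_cancel₀ _ (by positivity), Nat.ceil_natCast]

end BracketPow

namespace MvPolynomial

variable {σ k : Type*} [Field k] {p : ℕ} [Fact p.Prime] [CharP k p] [PerfectRing k p]

theorem smul_add_injective {q : ℕ} (hq : q ≠ 0) (a : σ →₀ ℕ) :
    Function.Injective fun b : σ →₀ ℕ ↦ q • b + a := fun b c h ↦ by
  ext i
  simpa [hq] using DFunLike.congr_fun h i

variable (p) in
/-- The coordinate of `h` at the monomial `x ^ a` when the polynomial ring is viewed as a free module
over the subring of `p ^ m`-th powers, with the `p ^ m`-th root of this coordinate taken. -/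
noncomputable def frobeniusCoord (m : ℕ) (a : σ →₀ ℕ) (h : MvPolynomial σ k) : MvPolynomial σ k :=
  AddMonoidAlgebra.ofCoeff <| Finsupp.mapRange (iterateFrobeniusEquiv k p m).symm (map_zero _) <|
    Finsupp.comapDomain (fun b : σ →₀ ℕ ↦ p ^ m • b + a) (AddMonoidAlgebra.coeff h)
      (smul_add_injective (pow_ne_zero m (Fact.out : p.Prime).ne_zero) a).injOn

theorem coeff_frobeniusCoord (m : ℕ) (a b : σ →₀ ℕ) (h : MvPolynomial σ k) :
    coeff b (frobeniusCoord p m a h) =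
      (iterateFrobeniusEquiv k p m).symm (coeff (p ^ m • b + a) h) :=
  rfl

theorem frobeniusCoord_add (m : ℕ) (a : σ →₀ ℕ) (g h : MvPolynomial σ k) :
    frobeniusCoord p m a (g + h) = frobeniusCoord p m a g + frobeniusCoord p m a h := by
  ext b
  simp [coeff_frobeniusCoord]

theorem frobeniusCoord_zero (m : ℕ) (a : σ →₀ ℕ) :
    frobeniusCoord p m a (0 : MvPolynomial σ k) = 0 := by
  ext b
  simp [coeff_frobeniusCoord]

theorem frobeniusCoord_sum {ι : Type*} (s : Finset ι) (m : ℕ) (a : σ →₀ ℕ)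
    (h : ι → MvPolynomial σ k) :
    frobeniusCoord p m a (∑ i ∈ s, h i) = ∑ i ∈ s, frobeniusCoord p m a (h i) := by
  ext b
  simp [coeff_frobeniusCoord, coeff_sum]

theorem frobeniusCoord_pow_mul (m : ℕ) {a : σ →₀ ℕ} (ha : ∀ i, a i < p ^ m)
    (g h : MvPolynomial σ k) :
    frobeniusCoord p m a (g ^ p ^ m * h) = g * frobeniusCoord p m a h := by
  induction g using induction_on' with
  | add g₁ g₂ h₁ h₂ => rw [add_pow_char_pow, add_mul, frobeniusCoord_add, h₁, h₂, add_mul]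
  | monomial s c =>
    ext b
    have hle : p ^ m • s ≤ p ^ m • b + a ↔ s ≤ b := by
      simp only [Finsupp.le_def, Finsupp.add_apply, Finsupp.smul_apply, smul_eq_mul]
      refine forall_congr' fun i ↦ ⟨fun hi ↦ ?_, fun hi ↦ ?_⟩
      · by_contra! hlt
        have := Nat.mul_le_mul_left (p ^ m) (Nat.succ_le_of_lt hlt)
        have := ha i
        rw [Nat.mul_succ] at *
        omega
      · exact (Nat.mul_le_mul_left _ hi).trans (Nat.le_add_right _ _)
    rw [coeff_frobeniusCoord, monomial_pow, coeff_monomial_mul', coeff_monomial_mul',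
      coeff_frobeniusCoord]
    simp only [hle]
    split_ifs with hsb
    · have hsub : p ^ m • b + a - p ^ m • s = p ^ m • (b - s) + a := by
        ext i
        have := Nat.mul_le_mul_left (p ^ m) (hsb i)
        simp only [Finsupp.tsub_apply, Finsupp.add_apply, Finsupp.smul_apply, smul_eq_mul,
          Nat.mul_sub]
        omega
      rw [hsub, map_mul, ← iterateFrobeniusEquiv_def, RingEquiv.symm_apply_apply]
    · exact map_zero _

/-- The exponent vector `s` reduced modulo `q`. -/
noncomputable def modExponent (q : ℕ) (s : σ →₀ ℕ) : σ →₀ ℕ :=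
  s.mapRange (· % q) (Nat.zero_mod q)

theorem smul_div_add_modExponent (q : ℕ) (s : σ →₀ ℕ) :
    q • s.mapRange (· / q) (Nat.zero_div q) + modExponent q s = s := by
  ext i
  simp [modExponent, Nat.div_add_mod]

theorem modExponent_smul_add (q : ℕ) (b : σ →₀ ℕ) {a : σ →₀ ℕ} (ha : ∀ i, a i < q) :
    modExponent q (q • b + a) = a := by
  ext i
  simp [modExponent, Nat.mod_eq_of_lt (ha i)]

theorem modExponent_lt {q : ℕ} (hq : 0 < q) (s : σ →₀ ℕ) (i : σ) : modExponent q s i < q := by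
  simpa [modExponent] using Nat.mod_lt _ hq

theorem ext_frobeniusCoord (m : ℕ) {g h : MvPolynomial σ k}
    (H : ∀ a : σ →₀ ℕ, (∀ i, a i < p ^ m) → frobeniusCoord p m a g = frobeniusCoord p m a h) :
    g = h := by
  ext s
  have := congrArg (coeff (s.mapRange (· / p ^ m) (Nat.zero_div _))) <| H (modExponent (p ^ m) s)
    (modExponent_lt (pow_pos (Fact.out : p.Prime).pos m) s)
  simpa [coeff_frobeniusCoord, smul_div_add_modExponent] using this

open scoped Classical in
theorem frobeniusCoord_monomial_one (m : ℕ) {a b : σ →₀ ℕ} (ha : ∀ i, a i < p ^ m)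
    (hb : ∀ i, b i < p ^ m) :
    frobeniusCoord p m b (monomial a (1 : k)) = if a = b then 1 else 0 := by
  ext c
  rw [coeff_frobeniusCoord, coeff_monomial]
  have hiff : a = p ^ m • c + b ↔ a = b ∧ c = 0 := by
    refine ⟨fun h ↦ ?_, by rintro ⟨rfl, rfl⟩; simp⟩
    have hab : a = b := by
      simpa [modExponent_smul_add, hb, h] using
        (by simpa using modExponent_smul_add (p ^ m) 0 ha : modExponent (p ^ m) a = a).symm
    refine ⟨hab, smul_add_injective (pow_ne_zero m (Fact.out : p.Prime).ne_zero) b ?_⟩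
    simpa [hab] using h.symm
  rw [if_congr hiff rfl rfl]
  by_cases hab : a = b <;> by_cases hc : c = 0 <;>
    simp [hab, hc, coeff_one, eq_comm (a := (0 : σ →₀ ℕ))]

open scoped Classical in
theorem sum_frobeniusCoord_pow_mul (m : ℕ) (h : MvPolynomial σ k) :
    ∑ a ∈ h.support.image (modExponent (p ^ m)),
      frobeniusCoord p m a h ^ p ^ m * monomial a 1 = h := by
  refine ext_frobeniusCoord (p := p) m fun b hb ↦ ?_
  rw [frobeniusCoord_sum]
  have hterm : ∀ a ∈ h.support.image (modExponent (p ^ m)),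
      frobeniusCoord p m b (frobeniusCoord p m a h ^ p ^ m * monomial a 1) =
        if a = b then frobeniusCoord p m b h else 0 := by
    intro a ha
    obtain ⟨s, -, rfl⟩ := Finset.mem_image.1 ha
    rw [frobeniusCoord_pow_mul m hb, frobeniusCoord_monomial_one m
      (modExponent_lt (pow_pos (Fact.out : p.Prime).pos m) s) hb]
    split_ifs with hs <;> simp [hs]
  rw [Finset.sum_congr rfl hterm, Finset.sum_ite_eq']
  split_ifs with hmem
  · rfl
  · ext c
    have hc : coeff (p ^ m • c + b) h = 0 := by
      by_contra hne
      exact hmem (Finset.mem_image.2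
        ⟨_, mem_support_iff.2 hne, modExponent_smul_add _ _ hb⟩)
    simp [coeff_frobeniusCoord, hc]

theorem mem_bracketPow_iff (m : ℕ) (J : Ideal (MvPolynomial σ k)) (h : MvPolynomial σ k) :
    h ∈ bracketPow J (p ^ m) ↔
      ∀ a : σ →₀ ℕ, (∀ i, a i < p ^ m) → frobeniusCoord p m a h ∈ J := by
  classical
  constructor
  · intro hh a ha
    induction hh using Submodule.closure_induction with
    | zero => exact (frobeniusCoord_zero (k := k) (p := p) m a).symm ▸ J.zero_mem
    | add x y _ _ hx hy => exact (frobeniusCoord_add m a x y).symm ▸ J.add_mem hx hy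
    | smul_mem r x hx =>
      obtain ⟨g, hg, rfl⟩ := hx
      dsimp only
      rw [smul_eq_mul, mul_comm, frobeniusCoord_pow_mul m ha]
      exact J.mul_mem_right _ hg
  · intro H
    rw [← sum_frobeniusCoord_pow_mul (p := p) m h]
    refine Ideal.sum_mem _ fun a ha ↦ Ideal.mul_mem_right _ _ (pow_mem_bracketPow (H a ?_) _)
    obtain ⟨s, -, rfl⟩ := Finset.mem_image.1 ha
    exact modExponent_lt (pow_pos (Fact.out : p.Prime).pos m) s

theorem rootIdeal_eq_span_frobeniusCoord (m : ℕ) (h : MvPolynomial σ k) :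
    rootIdeal h (p ^ m) =
      Ideal.span {g | ∃ a : σ →₀ ℕ, (∀ i, a i < p ^ m) ∧ frobeniusCoord p m a h = g} := by
  apply le_antisymm
  · exact sInf_le ((mem_bracketPow_iff m _ h).2 fun a ha ↦ Ideal.subset_span ⟨a, ha, rfl⟩)
  · refine le_sInf fun J hJ ↦ Ideal.span_le.2 ?_
    rintro _ ⟨a, ha, rfl⟩
    exact (mem_bracketPow_iff m J h).1 hJ a ha

theorem mem_bracketPow_of_pow_mul_mem {m q : ℕ} {J : Ideal (MvPolynomial σ k)}
    {g h : MvPolynomial σ k} (h0 : h ≠ 0) (hdeg : h.totalDegree < p ^ m)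
    (hmem : g ^ p ^ m * h ∈ bracketPow J (q * p ^ m)) : g ∈ bracketPow J q := by
  obtain ⟨a, ha⟩ := ne_zero_iff.1 h0
  have hlt : ∀ s ∈ h.support, ∀ i, s i < p ^ m := fun s hs i ↦
    ((degreeOf_le_iff.1 (degreeOf_le_totalDegree h i) s hs)).trans_lt hdeg
  have halt := hlt a (mem_support_iff.2 ha)
  have hcoord : frobeniusCoord p m a h = C ((iterateFrobeniusEquiv k p m).symm (coeff a h)) := by
    classical
    ext b
    rw [coeff_frobeniusCoord, coeff_C]
    split_ifs with hb
    · simp [← hb]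
    · rw [map_eq_zero_iff _ (RingEquiv.injective _)]
      by_contra hne
      refine hb (Finsupp.ext fun i ↦ ?_)
      have := hlt _ (mem_support_iff.2 hne) i
      simp only [Finsupp.add_apply, Finsupp.smul_apply, smul_eq_mul] at this
      by_contra hi
      have := Nat.le_mul_of_pos_right (p ^ m) (Nat.pos_of_ne_zero (Ne.symm hi))
      omega
  have hg := (mem_bracketPow_iff m _ _).1 (bracketPow_mul_le J q (p ^ m) hmem) a halt
  rw [frobeniusCoord_pow_mul m halt, hcoord] at hg
  refine (Ideal.mul_unit_mem_iff_mem _ (IsUnit.map C (IsUnit.mk0 _ ?_))).1 hg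
  simpa using ha

theorem rootIdeal_le_rootIdeal_pow_mul {m : ℕ} (q : ℕ) (g : MvPolynomial σ k)
    {h : MvPolynomial σ k} (h0 : h ≠ 0) (hdeg : h.totalDegree < p ^ m) :
    rootIdeal g q ≤ rootIdeal (g ^ p ^ m * h) (q * p ^ m) :=
  rootIdeal_le_rootIdeal fun _ ↦ mem_bracketPow_of_pow_mul_mem h0 hdeg

theorem totalDegree_frobeniusCoord_le {m d : ℕ} (a : σ →₀ ℕ) {h : MvPolynomial σ k}
    (hd : h.totalDegree ≤ p ^ m * d) : (frobeniusCoord p m a h).totalDegree ≤ d := by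
  refine Finset.sup_le fun b hb ↦ ?_
  have hne : coeff (p ^ m • b + a) h ≠ 0 := by
    rw [mem_support_iff, coeff_frobeniusCoord] at hb
    exact fun h0 ↦ hb (by simp [h0])
  have hle := (le_totalDegree (mem_support_iff.2 hne)).trans hd
  change Finsupp.degree (p ^ m • b + a) ≤ _ at hle
  rw [map_add, map_nsmul, smul_eq_mul] at hle
  exact Nat.le_of_mul_le_mul_left ((Nat.le_add_right _ _).trans hle)
    (pow_pos (Fact.out : p.Prime).pos m)

theorem exists_levelChain_eq [Finite σ] (f : MvPolynomial σ k) :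
    ∃ e, ∀ e', e ≤ e' → levelChain f p e' = levelChain f p e := by
  let V := restrictTotalDegree σ k f.totalDegree
  let u : ℕ →o (Submodule k V)ᵒᵈ :=
    ⟨fun e ↦ OrderDual.toDual (((levelChain f p e).restrictScalars k).comap V.subtype),
      fun a b hab ↦ Submodule.comap_mono
        (show (levelChain f p b).restrictScalars k ≤ (levelChain f p a).restrictScalars k from
          levelChain_antitone f hab)⟩
  obtain ⟨e, he⟩ := IsArtinian.monotone_stabilizes u
  refine ⟨e, fun e' hee' ↦ le_antisymm (levelChain_antitone f hee') ?_⟩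
  rw [levelChain, rootIdeal_eq_span_frobeniusCoord, Ideal.span_le]
  rintro g hg
  have hgmem : g ∈ levelChain f p e := by
    rw [levelChain, rootIdeal_eq_span_frobeniusCoord]
    exact Ideal.subset_span hg
  have hgV : g ∈ V := by
    obtain ⟨a, -, rfl⟩ := hg
    refine (mem_restrictTotalDegree _ _ _).2 (totalDegree_frobeniusCoord_le a ?_)
    exact (totalDegree_pow _ _).trans (Nat.mul_le_mul_right _ (Nat.sub_le _ _))
  have hmem : (⟨g, hgV⟩ : V) ∈ ((levelChain f p e).restrictScalars k).comap V.subtype := hgmem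
  have heq : ((levelChain f p e).restrictScalars k).comap V.subtype =
      ((levelChain f p e').restrictScalars k).comap V.subtype := he e' hee'
  exact (heq ▸ hmem : _ ∈ ((levelChain f p e').restrictScalars k).comap V.subtype)

theorem monotone_rootIdeal_ceil (f : MvPolynomial σ k) (lam : ℝ) :
    Monotone fun e : ℕ ↦ rootIdeal (f ^ ⌈lam * (p : ℝ) ^ e⌉₊) (p ^ e) := by
  refine monotone_nat_of_le_succ fun e ↦ ?_
  have hceil : ⌈lam * (p : ℝ) ^ (e + 1)⌉₊ ≤ ⌈lam * (p : ℝ) ^ e⌉₊ * p ^ 1 := by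
    rw [Nat.ceil_le]
    push_cast
    rw [pow_succ, ← mul_assoc, pow_one]
    exact mul_le_mul_of_nonneg_right (Nat.le_ceil _) (Nat.cast_nonneg _)
  calc rootIdeal (f ^ ⌈lam * (p : ℝ) ^ e⌉₊) (p ^ e)
      ≤ rootIdeal ((f ^ ⌈lam * (p : ℝ) ^ e⌉₊) ^ p ^ 1 * 1) (p ^ e * p ^ 1) :=
        rootIdeal_le_rootIdeal_pow_mul _ _ one_ne_zero
          (by simpa using (Fact.out : p.Prime).pos)
    _ ≤ _ := by
        rw [mul_one, ← pow_mul, ← pow_add]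
        exact rootIdeal_pow_anti f _ hceil

theorem exists_testIdeal_eq [Finite σ] (f : MvPolynomial σ k) (lam : ℝ) (e₀ : ℕ) :
    ∃ e, e₀ ≤ e ∧ testIdeal f p lam = rootIdeal (f ^ ⌈lam * (p : ℝ) ^ e⌉₊) (p ^ e) := by
  have hmono := monotone_rootIdeal_ceil (p := p) f lam
  obtain ⟨N, hN⟩ := monotone_stabilizes_iff_noetherian.2
    (inferInstance : IsNoetherian (MvPolynomial σ k) (MvPolynomial σ k)) ⟨_, hmono⟩
  refine ⟨max e₀ N, le_max_left _ _, le_antisymm (iSup_le fun e ↦ ?_) (le_iSup_of_le _ le_rfl)⟩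
  have h₁ := hN (max e₀ N) (le_max_right _ _)
  have h₂ := hN (max e N) (le_max_right _ _)
  exact (hmono (le_max_left e N)).trans (h₂.symm.trans h₁).le

theorem exists_lt_testIdeal_le [Finite σ] {f : MvPolynomial σ k} (hf : f ≠ 0) (lam : ℝ) :
    ∃ mu, lam < mu ∧ testIdeal f p lam ≤ testIdeal f p mu := by
  have hp := (Fact.out : p.Prime)
  obtain ⟨e, -, he⟩ := exists_testIdeal_eq (p := p) f lam 0
  set r := ⌈lam * (p : ℝ) ^ e⌉₊
  obtain ⟨m, hm⟩ : ∃ m, f.totalDegree < p ^ m := ⟨_, Nat.lt_pow_self hp.one_lt⟩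
  refine ⟨((r * p ^ m + 1 : ℕ) : ℝ) / (p : ℝ) ^ (e + m), ?_, ?_⟩
  · have hp0 : (0 : ℝ) < p := mod_cast hp.pos
    rw [lt_div_iff₀ (by positivity)]
    have : lam * (p : ℝ) ^ e * (p : ℝ) ^ m ≤ r * (p : ℝ) ^ m :=
      mul_le_mul_of_nonneg_right (Nat.le_ceil _) (by positivity)
    push_cast
    rw [pow_add]
    linarith
  · refine le_trans ?_ (rootIdeal_le_testIdeal hp.pos f _ _)
    rw [he, pow_succ, pow_mul, pow_add]
    exact rootIdeal_le_rootIdeal_pow_mul _ _ hf hm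

theorem testIdeal_eq_levelChain [Finite σ] (f : MvPolynomial σ k) (e : ℕ) :
    testIdeal f p (1 - 1 / (p : ℝ) ^ e) = levelChain f p e := by
  have hp := (Fact.out : p.Prime)
  have hp0 : (p : ℝ) ≠ 0 := mod_cast hp.ne_zero
  have hcast : ((p ^ e - 1 : ℕ) : ℝ) = (p : ℝ) ^ e - 1 := by
    rw [Nat.cast_sub (Nat.one_le_pow _ _ hp.pos)]
    simp
  apply le_antisymm
  · obtain ⟨N, hN, heq⟩ := exists_testIdeal_eq (p := p) f (1 - 1 / (p : ℝ) ^ e) e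
    obtain ⟨m, rfl⟩ := Nat.exists_eq_add_of_le hN
    have hexp : (1 - 1 / (p : ℝ) ^ e) * (p : ℝ) ^ (e + m) = ((p ^ e - 1) * p ^ m : ℕ) := by
      push_cast [hcast]
      rw [pow_add]
      field_simp
    rw [heq, hexp, Nat.ceil_natCast, pow_mul, pow_add]
    exact rootIdeal_pow_le _ _ _
  · have hlam : (1 - 1 / (p : ℝ) ^ e) = ((p ^ e - 1 : ℕ) : ℝ) / (p : ℝ) ^ e := by
      rw [hcast]
      field_simp
    rw [hlam]
    exact rootIdeal_le_testIdeal hp.pos f _ _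

theorem testIdeal_eq_top_of_lt_one [Finite σ] {f : MvPolynomial σ k}
    (htop : ∀ e, levelChain f p e = ⊤) {lam : ℝ} (hlam : lam < 1) : testIdeal f p lam = ⊤ := by
  have hp : (1 : ℝ) < p := mod_cast (Fact.out : p.Prime).one_lt
  obtain ⟨e, he⟩ := exists_pow_lt_of_lt_one (sub_pos.2 hlam) (inv_lt_one_of_one_lt₀ hp)
  have hle : lam ≤ 1 - 1 / (p : ℝ) ^ e := by
    rw [inv_pow, inv_eq_one_div] at he
    linarith
  exact top_le_iff.1 (((testIdeal_eq_levelChain f e).trans (htop e)).ge.trans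
    (testIdeal_antitone f p hle))

theorem exists_isFJumpingExponent [Finite σ] {f : MvPolynomial σ k} (hf : f ≠ 0) {a b : ℝ}
    (ha : 0 < a) (hab : ¬ testIdeal f p a ≤ testIdeal f p b) :
    ∃ lam, IsFJumpingExponent f p lam ∧ a < lam ∧ lam ≤ b := by
  set S : Set ℝ := {lam | testIdeal f p a ≤ testIdeal f p lam}
  have hdown : ∀ x ∈ S, ∀ y ≤ x, y ∈ S := fun x hx y hyx ↦
    le_trans hx (testIdeal_antitone f p hyx)
  have hub : b ∈ upperBounds S := fun x hx ↦ not_lt.1 fun hbx ↦ hab (hdown x hx b hbx.le)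
  have haS : a ∈ S := le_refl (testIdeal f p a)
  have hnot : sSup S ∉ S := fun hmem ↦ by
    obtain ⟨mu, hlt, hle⟩ := exists_lt_testIdeal_le (p := p) hf (sSup S)
    exact hlt.not_ge (le_csSup ⟨b, hub⟩ (le_trans hmem hle))
  have hlt : a < sSup S :=
    (le_csSup ⟨b, hub⟩ haS).lt_of_ne fun h ↦ hnot (h ▸ haS)
  refine ⟨sSup S, ⟨ha.trans hlt, fun mu _ hmu heq ↦ hnot ?_⟩, hlt, csSup_le ⟨a, haS⟩ hub⟩
  obtain ⟨x, hx, hmx⟩ := exists_lt_of_lt_csSup ⟨a, haS⟩ hmu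
  exact (hdown x hx mu hmx.le).trans heq.le

end MvPolynomial

theorem level_one_no_jumping_and_level_gt_two_jumping {k : Type*} [Field k] [PerfectField k]
    {p n : ℕ} [CharP k p] (hp : 2 < p)
    (f : MvPolynomial (Fin (n + 1)) k) (hf : f ≠ 0) :
    (level f p = 1 → ∀ lam : ℝ, 0 < lam → lam < 1 → ¬ IsFJumpingExponent f p lam) ∧
    (2 < level f p → ∃ lam : ℝ, IsFJumpingExponent f p lam ∧
        1 - 1 / (p : ℝ) < lam ∧ lam < 1) := by
  have : Fact p.Prime := ⟨(CharP.char_is_prime_or_zero k p).resolve_right (by omega)⟩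
  constructor
  · intro hlevel lam h0 h1 hjump
    have hzero : sInf {e : ℕ | ∀ e', e ≤ e' → levelChain f p e' = levelChain f p e} = 0 :=
      Nat.succ_injective hlevel
    have hmem := Nat.sInf_mem (s := {e : ℕ | ∀ e', e ≤ e' → levelChain f p e' = levelChain f p e})
      (MvPolynomial.exists_levelChain_eq f)
    rw [hzero] at hmem
    have htop : ∀ e, levelChain f p e = ⊤ := fun e ↦
      (hmem e e.zero_le).trans (levelChain_zero f p)
    refine hjump.2 (lam / 2) (by linarith) (by linarith) ?_
    rw [MvPolynomial.testIdeal_eq_top_of_lt_one htop h1,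
      MvPolynomial.testIdeal_eq_top_of_lt_one htop (by linarith)]
  · intro hlevel
    have hnot : 1 ∉ {e : ℕ | ∀ e', e ≤ e' → levelChain f p e' = levelChain f p e} :=
      Nat.notMem_of_lt_sInf (Nat.succ_lt_succ_iff.1 hlevel)
    simp only [Set.mem_ofPred_eq, not_forall] at hnot
    obtain ⟨e, he, hne⟩ := hnot
    have hp2 : (2 : ℝ) < p := mod_cast hp
    obtain ⟨lam, hjump, hlt, hle⟩ := MvPolynomial.exists_isFJumpingExponent (p := p) hf
      (a := 1 - 1 / (p : ℝ) ^ 1) (b := 1 - 1 / (p : ℝ) ^ e)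
      (by
        rw [pow_one, sub_pos, div_lt_one (by linarith)]
        linarith)
      (by
        rw [MvPolynomial.testIdeal_eq_levelChain, MvPolynomial.testIdeal_eq_levelChain]
        exact fun h ↦ hne (le_antisymm (levelChain_antitone f he) h))
    rw [pow_one] at hlt
    exact ⟨lam, hjump, hlt, hle.trans_lt (sub_lt_self _ (by positivity))⟩
end

section
/- Let p be a prime and n ≥ 1 an integer with p > n and p ≡ 1 (mod n+1). Then f_n^{p−1} does not belong to the ideal (x₀^p, x₁^p, …, x_n^p) of 𝔽_p[x₀,…,x_n]. -/
open MvPolynomial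

/-- The Fermat polynomial `f_n = x₀^{n+1} + … + x_n^{n+1}` over `𝔽_p`. -/
noncomputable def fermat (p n : ℕ) : MvPolynomial (Fin (n + 1)) (ZMod p) :=
  ∑ i : Fin (n + 1), X i ^ (n + 1)

namespace MvPolynomial

/-- A polynomial in the ideal generated by the `k`-th powers of the variables has no monomial
all of whose exponents are less than `k`. -/
theorem coeff_eq_zero_of_mem_span_X_pow {σ R : Type*} [CommSemiring R] {k : ℕ}
    {f : MvPolynomial σ R}
    (hf : f ∈ Ideal.span (Set.range fun i : σ => (X i : MvPolynomial σ R) ^ k))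
    {d : σ →₀ ℕ} (hd : ∀ i, d i < k) : coeff d f = 0 := by
  have hrange : (Set.range fun i : σ => (X i : MvPolynomial σ R) ^ k) =
      (fun s => monomial s (1 : R)) '' Set.range fun i : σ => Finsupp.single i k := by
    rw [← Set.range_comp]
    simp [X_pow_eq_monomial, Function.comp_def]
  rw [hrange, mem_ideal_span_monomial_image] at hf
  by_contra h
  obtain ⟨_, ⟨i, rfl⟩, hle⟩ := hf d (mem_support_iff.mpr h)
  exact (hd i).not_ge (by simpa using hle i)

end MvPolynomial

/-- A multinomial coefficient whose total is less than the prime `p` is prime to `p`. -/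
theorem Nat.Prime.not_dvd_multinomial {ι : Type*} {p : ℕ} (hp : p.Prime) {s : Finset ι}
    {k : ι → ℕ} (h : ∑ i ∈ s, k i < p) : ¬ p ∣ Nat.multinomial s k := fun hdvd =>
  h.not_ge (hp.dvd_factorial.mp (Nat.multinomial_spec s k ▸ hdvd.mul_left _))

/-- If `p > n` and `p ≡ 1 (mod n+1)` then `f_n^{p-1}` is not in the ideal
`(x₀^p, …, x_n^p)`. -/
theorem fermat_pow_not_mem_frobenius_ideal (p n : ℕ) (hp : p.Prime) (hn : 1 ≤ n)
    (hpn : n < p) (hmod : p % (n + 1) = 1) :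
    (fermat p n) ^ (p - 1) ∉
      Ideal.span (Set.range fun i : Fin (n + 1) =>
        (X i : MvPolynomial (Fin (n + 1)) (ZMod p)) ^ p) := by
  intro hmem
  have hpos := hp.pos
  obtain ⟨m, hm⟩ : n + 1 ∣ p - 1 := (Nat.modEq_iff_dvd' hpos).mp
    (by rw [Nat.ModEq, hmod, Nat.mod_eq_of_lt (by omega)])
  let e : Fin (n + 1) →₀ ℕ := Finsupp.equivFunOnFinite.symm fun _ => m
  have hsum : ∑ i, e i = p - 1 := by simp [e, hm]
  have hzero : coeff ((n + 1) • e) (fermat p n ^ (p - 1)) = 0 :=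
    coeff_eq_zero_of_mem_span_X_pow hmem fun i => by
      simp only [Finsupp.smul_apply, smul_eq_mul, e, Finsupp.equivFunOnFinite_symm_apply_apply]
      omega
  have hexpand : fermat p n = expand (n + 1) (∑ i, X i) := by simp [fermat]
  rw [hexpand, ← map_pow, coeff_expand_smul _ n.succ_ne_zero, coeff_sum_X_pow_of_fintype,
    if_pos (by rw [← hsum, Finsupp.sum_fintype _ _ fun _ => rfl]), ZMod.natCast_eq_zero_iff,
    Finsupp.multinomial_eq_of_support_subset (Finset.subset_univ _)] at hzero
  exact hp.not_dvd_multinomial (by omega) hzero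
end

section
/- Let p be a prime with p > n ≥ 2 and p ≡ 1 (mod n+1). Then there exists a nonzero c ∈ 𝔽_p such that (D_{p−1,0} ∘ D_{p−1,1} ∘ ⋯ ∘ D_{p−1,n})(f_n^{p²−1}) = c · f_n^{p²−p} in 𝔽_p[x₀,…,x_n] (so that, up to a nonzero constant, Ψ₁ = ∏_{i=0}^{n} D_{p−1,i} is also an operator of level 2 for f_n). -/
open MvPolynomial

/-- The differential operator `D_{t,i}`, acting on a monomial `x₀^{a₀}⋯x_n^{a_n}` by
`D_{t,i}(x₀^{a₀}⋯x_n^{a_n}) = C(a_i, t) · x₀^{a₀}⋯x_i^{a_i-t}⋯x_n^{a_n}` if `a_i ≥ t`,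
and by `0` otherwise. -/
noncomputable def Dop (p n t : ℕ) (i : Fin (n + 1))
    (g : MvPolynomial (Fin (n + 1)) (ZMod p)) : MvPolynomial (Fin (n + 1)) (ZMod p) :=
  ∑ d ∈ g.support,
    if t ≤ d i then
      monomial (d - Finsupp.single i t) ((((d i).choose t : ℕ) : ZMod p) * coeff d g)
    else 0

/-- The composite operator `Ψ = D_{t,0} ∘ D_{t,1} ∘ ⋯ ∘ D_{t,n}`. -/
noncomputable def Psi (p n t : ℕ) :
    MvPolynomial (Fin (n + 1)) (ZMod p) → MvPolynomial (Fin (n + 1)) (ZMod p) :=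
  (List.ofFn fun i : Fin (n + 1) => Dop p n t i).foldr (· ∘ ·) id

theorem coeff_Dop (p n t : ℕ) (i : Fin (n + 1)) (g : MvPolynomial (Fin (n + 1)) (ZMod p))
    (m : Fin (n + 1) →₀ ℕ) :
    coeff m (Dop p n t i g) =
      (((m i + t).choose t : ℕ) : ZMod p) * coeff (m + Finsupp.single i t) g := by
  classical
  rw [Dop, coeff_sum, Finset.sum_eq_single (m + Finsupp.single i t)]
  · simp
  · intro d _ hd
    split_ifs with h
    · rw [coeff_monomial, if_neg]
      rintro rfl
      refine hd (tsub_add_cancel_of_le ?_).symm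
      simpa using h
    · simp
  · intro h
    simp [notMem_support_iff.mp h]

theorem coeff_foldr_Dop (p n t : ℕ) (l : List (Fin (n + 1))) (hl : l.Nodup)
    (g : MvPolynomial (Fin (n + 1)) (ZMod p)) (m : Fin (n + 1) →₀ ℕ) :
    coeff m ((l.map (Dop p n t)).foldr (· ∘ ·) id g) =
      (l.map fun i => (((m i + t).choose t : ℕ) : ZMod p)).prod *
        coeff (m + (l.map fun i => Finsupp.single i t).sum) g := by
  induction l generalizing m with
  | nil => simp
  | cons i l ih =>
    obtain ⟨hi, hl⟩ := List.nodup_cons.mp hl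
    have hmap : (l.map fun j => ((((m + Finsupp.single i t) j + t).choose t : ℕ) : ZMod p)) =
        l.map fun j => (((m j + t).choose t : ℕ) : ZMod p) := by
      refine List.map_congr_left fun j hj => ?_
      have hij : i ≠ j := fun h => hi (h ▸ hj)
      simp [hij]
    simp only [List.map_cons, List.foldr_cons, Function.comp_apply, List.prod_cons, List.sum_cons]
    rw [coeff_Dop, ih hl, hmap, mul_assoc, add_assoc]

theorem coeff_Psi (p n t : ℕ) (g : MvPolynomial (Fin (n + 1)) (ZMod p))
    (m : Fin (n + 1) →₀ ℕ) :
    coeff m (Psi p n t g) =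
      (∏ i, (((m i + t).choose t : ℕ) : ZMod p)) *
        coeff (m + Finsupp.equivFunOnFinite.symm fun _ => t) g := by
  rw [Psi, List.ofFn_eq_map, coeff_foldr_Dop p n t _ (List.nodup_finRange _)]
  simp only [← List.ofFn_eq_map, List.prod_ofFn, List.sum_ofFn]
  congr 3
  ext j
  simp [Finsupp.finsetSum_apply, Finsupp.single_apply]

theorem natCast_choose_add_sub_one {p : ℕ} (hp : p.Prime) (a : ℕ) :
    (((a + (p - 1)).choose (p - 1) : ℕ) : ZMod p) = if p ∣ a then 1 else 0 := by
  have := Fact.mk hp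
  have hp1 : p - 1 < p := Nat.sub_lt hp.pos one_pos
  have h := (ZMod.natCast_eq_natCast_iff _ _ _).mpr
    (Choose.choose_modEq_choose_mod_mul_choose_div_nat (n := a + (p - 1)) (k := p - 1) (p := p))
  rw [h, Nat.mod_eq_of_lt hp1, Nat.div_eq_of_lt hp1, Nat.choose_zero_right, mul_one]
  split_ifs with hd
  · obtain ⟨b, rfl⟩ := hd
    rw [Nat.mul_add_mod, Nat.mod_eq_of_lt hp1, Nat.choose_self, Nat.cast_one]
  · rw [Nat.choose_eq_zero_of_lt, Nat.cast_zero]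
    refine lt_of_le_of_ne (Nat.le_pred_of_lt (Nat.mod_lt _ hp.pos)) fun h => hd ?_
    have h' : a + (p - 1) ≡ 0 + (p - 1) [MOD p] := by
      rw [Nat.ModEq, h, zero_add, Nat.mod_eq_of_lt hp1]
    exact (Nat.modEq_zero_iff_dvd).mp (Nat.ModEq.add_right_cancel' _ h')

theorem coeff_Psi_sub_one {p : ℕ} (hp : p.Prime) (n : ℕ)
    (g : MvPolynomial (Fin (n + 1)) (ZMod p)) (m : Fin (n + 1) →₀ ℕ) :
    coeff m (Psi p n (p - 1) g) =
      if ∀ i, p ∣ m i then coeff (m + Finsupp.equivFunOnFinite.symm fun _ => p - 1) g else 0 := by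
  simp only [coeff_Psi, natCast_choose_add_sub_one hp, Finset.prod_ite_zero, Finset.mem_univ,
    true_imp_iff, Finset.prod_const_one, ite_mul, one_mul, zero_mul]

theorem Psi_add {p : ℕ} (n t : ℕ) (g h : MvPolynomial (Fin (n + 1)) (ZMod p)) :
    Psi p n t (g + h) = Psi p n t g + Psi p n t h := by
  ext m
  simp only [coeff_Psi, coeff_add, mul_add]

theorem Psi_sub_one_monomial_mul {p : ℕ} (hp : p.Prime) (n : ℕ) (s : Fin (n + 1) →₀ ℕ)
    (a : ZMod p) (g : MvPolynomial (Fin (n + 1)) (ZMod p)) :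
    Psi p n (p - 1) (monomial (p • s) a * g) = monomial (p • s) a * Psi p n (p - 1) g := by
  have hp0 := hp.pos
  ext m
  rw [coeff_Psi_sub_one hp, coeff_monomial_mul', coeff_monomial_mul', coeff_Psi_sub_one hp]
  by_cases hle : p • s ≤ m
  · obtain ⟨r, rfl⟩ := exists_add_of_le hle
    rw [add_assoc, if_pos le_self_add, if_pos le_self_add, add_tsub_cancel_left,
      add_tsub_cancel_left, mul_ite, mul_zero]
    refine if_congr (forall_congr' fun i => ?_) rfl rfl
    simp [(Nat.dvd_add_right (dvd_mul_right p (s i)))]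
  · rw [if_neg hle]
    split_ifs with hd hle'
    · refine absurd (fun i => ?_) hle
      obtain ⟨b, hb⟩ := hd i
      have hi := hle' i
      simp only [Finsupp.smul_apply, smul_eq_mul, Finsupp.add_apply,
        Finsupp.equivFunOnFinite_symm_apply_apply, hb] at hi ⊢
      refine Nat.mul_le_mul_left _ (Nat.lt_succ_iff.mp (Nat.lt_of_mul_lt_mul_left (a := p) ?_))
      rw [Nat.mul_succ]
      omega
    · rfl
    · rfl

theorem Psi_sub_one_expand_mul {p : ℕ} (hp : p.Prime) (n : ℕ)
    (h g : MvPolynomial (Fin (n + 1)) (ZMod p)) :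
    Psi p n (p - 1) (expand p h * g) = expand p h * Psi p n (p - 1) g := by
  induction h using MvPolynomial.induction_on' with
  | monomial s a => rw [expand_monomial, Psi_sub_one_monomial_mul hp]
  | add h₁ h₂ ih₁ ih₂ => rw [map_add, add_mul, Psi_add, ih₁, ih₂, add_mul]

theorem fermat_isHomogeneous (p n : ℕ) : (fermat p n).IsHomogeneous (n + 1) :=
  IsHomogeneous.sum _ _ _ fun i _ => isHomogeneous_X_pow i (n + 1)

theorem Psi_sub_one_fermat_pow_sub_one {p : ℕ} (hp : p.Prime) (n : ℕ) :
    Psi p n (p - 1) (fermat p n ^ (p - 1)) =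
      C (coeff (Finsupp.equivFunOnFinite.symm fun _ => p - 1) (fermat p n ^ (p - 1))) := by
  classical
  ext m
  rw [coeff_Psi_sub_one hp, coeff_C]
  split_ifs with hd hm hm
  · rw [← hm, zero_add]
  · refine ((fermat_isHomogeneous p n).pow (p - 1)).coeff_eq_zero fun h => hm ?_
    rw [map_add, Finsupp.degree_eq_sum (Finsupp.equivFunOnFinite.symm _)] at h
    simp only [Finsupp.equivFunOnFinite_symm_apply_apply, Finset.sum_const, Finset.card_univ,
      Fintype.card_fin, smul_eq_mul, Nat.add_eq_right, Finsupp.degree_eq_zero_iff] at h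
    exact h.symm
  · exact absurd (fun i => by simp [← hm]) hd
  · rfl

theorem coeff_fermat_pow_mul (p n q : ℕ) :
    coeff (Finsupp.equivFunOnFinite.symm fun _ => (n + 1) * q)
      (fermat p n ^ ((n + 1) * q)) =
      ((Nat.multinomial Finset.univ fun _ : Fin (n + 1) => q : ℕ) : ZMod p) := by
  classical
  have hprod (k : Fin (n + 1) → ℕ) :
      (∏ i, ((X i : MvPolynomial (Fin (n + 1)) (ZMod p)) ^ (n + 1)) ^ k i) =
        monomial (Finsupp.equivFunOnFinite.symm fun i => (n + 1) * k i) 1 := by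
    rw [monomial_eq, Finsupp.prod_fintype _ _ fun _ => pow_zero _]
    simp [pow_mul]
  rw [fermat, Finset.sum_pow_eq_sum_piAntidiag, coeff_sum,
    Finset.sum_eq_single fun _ => q]
  · rw [hprod, ← C_eq_coe_nat, coeff_C_mul, coeff_monomial, if_pos rfl, mul_one]
  · intro k _ hk
    rw [hprod, ← C_eq_coe_nat, coeff_C_mul, coeff_monomial, if_neg, mul_zero]
    refine fun h => hk (funext fun i => ?_)
    have := DFunLike.congr_fun h i
    simpa using this
  · intro h
    exact absurd (by simp [Finset.mem_piAntidiag]) h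

theorem coeff_fermat_pow_sub_one_ne_zero {p n : ℕ} (hp : p.Prime) (hmod : p % (n + 1) = 1) :
    coeff (Finsupp.equivFunOnFinite.symm fun _ => p - 1) (fermat p n ^ (p - 1)) ≠ 0 := by
  have hone := Nat.mod_mod p (n + 1)
  rw [hmod] at hone
  obtain ⟨q, hq⟩ : n + 1 ∣ p - 1 :=
    (Nat.modEq_iff_dvd' hp.one_le).mp (hone.trans hmod.symm)
  rw [hq, coeff_fermat_pow_mul, Ne, ZMod.natCast_eq_zero_iff]
  intro h
  have hspec := Nat.multinomial_spec Finset.univ fun _ : Fin (n + 1) => q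
  have hdvd : p ∣ (p - 1).factorial := by
    simpa [hq] using (h.mul_left _).trans hspec.dvd
  exact (Nat.sub_lt hp.pos one_pos).not_ge (hp.dvd_factorial.mp hdvd)

/-- If `p > n ≥ 2` and `p ≡ 1 (mod n+1)` then `Ψ₁ = ∏ᵢ D_{p-1,i}` sends
`f_n^{p²-1}` to a nonzero constant multiple of `f_n^{p²-p}`: it is an operator of
level `2` for `f_n`. -/
theorem Psi_one_fermat_level_two (p n : ℕ) (hp : p.Prime) (hn : 2 ≤ n)
    (hpn : n < p) (hmod : p % (n + 1) = 1) :
    ∃ c : ZMod p, c ≠ 0 ∧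
      Psi p n (p - 1) ((fermat p n) ^ (p ^ 2 - 1)) = C c * (fermat p n) ^ (p ^ 2 - p) := by
  have := Fact.mk hp
  refine ⟨_, coeff_fermat_pow_sub_one_ne_zero hp hmod, ?_⟩
  have hexp : expand p (fermat p n ^ (p - 1)) = fermat p n ^ (p ^ 2 - p) := by
    rw [MvPolynomial.expand_zmod, ← pow_mul, Nat.sub_mul, one_mul, sq]
  have hsplit : p ^ 2 - 1 = (p ^ 2 - p) + (p - 1) := by
    have := Nat.le_self_pow two_ne_zero p
    have := hp.one_le
    omega
  rw [hsplit, pow_add, ← hexp, Psi_sub_one_expand_mul hp, Psi_sub_one_fermat_pow_sub_one hp,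
    mul_comm]
end
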